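/- Let Γ be a two-player zero-sum recursive game with countable state space and finite action sets at each state. The sequence of n-stage values (v_n)_{n≥1} converges uniformly on X as n → ∞ if and only if the family of λ-discounted values (v_λ)_{λ∈(0,1]} converges uniformly on X as λ → 0; and in case of convergence, both limits are the same function. -/

import Mathlib

open scoped Classical
open Filter

noncomputable section

/-- A two-player zero-sum stochastic game: a state space `X`, action sets `A`, `B`
with a nonempty finite feasible subset at every state, a payoff function with values
in `[-1,1]`, and a finitely supported transition probability function. -/
structure StocGame where
  X : Type
  A : Type
  B : Type
  actA : X → Finset A
  actB : X → Finset B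
  actA_nonempty : ∀ x, (actA x).Nonempty
  actB_nonempty : ∀ x, (actB x).Nonempty
  g : X → A → B → ℝ
  g_bdd : ∀ x a b, |g x a b| ≤ 1
  q : X → A → B → X → ℝ
  q_nonneg : ∀ x a b y, 0 ≤ q x a b y
  q_finsupp : ∀ x a b, (Function.support (q x a b)).Finite
  q_sum : ∀ x a b, (∑' y, q x a b y) = 1

namespace StocGame

variable (G : StocGame)

/-- A behavior strategy of player 1: to every past history (a chronological list of
(state, action of player 1, action of player 2) triples) and every current state, it
assigns a mixed action supported on the feasible action set. -/
structure Strategy1 where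
  play : List (G.X × G.A × G.B) → G.X → G.A → ℝ
  nonneg : ∀ h x a, 0 ≤ play h x a
  supp : ∀ h x a, a ∉ G.actA x → play h x a = 0
  sum_one : ∀ h x, ∑ a ∈ G.actA x, play h x a = 1

/-- A behavior strategy of player 2. -/
structure Strategy2 where
  play : List (G.X × G.A × G.B) → G.X → G.B → ℝ
  nonneg : ∀ h x b, 0 ≤ play h x b
  supp : ∀ h x b, b ∉ G.actB x → play h x b = 0
  sum_one : ∀ h x, ∑ b ∈ G.actB x, play h x b = 1

variable {G}

/-- The chronological sequence of states visited along a finite history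
(past history together with the current state). -/
def stateSeq (hx : List (G.X × G.A × G.B) × G.X) : List G.X :=
  hx.1.map Prod.fst ++ [hx.2]

/-- A strategy of player 1 which depends on the history only through the sequence of
visited states (and not on past actions). -/
def Strategy1.stateDep (σ : Strategy1 G) : Prop :=
  ∀ h h' x, h.map Prod.fst = h'.map Prod.fst → σ.play h x = σ.play h' x

/-- A strategy of player 2 which depends on the history only through the sequence of
visited states (and not on past actions). -/
def Strategy2.stateDep (τ : Strategy2 G) : Prop :=
  ∀ h h' x, h.map Prod.fst = h'.map Prod.fst → τ.play h x = τ.play h' x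

/-- A pure strategy of player 1. -/
def Strategy1.pure (σ : Strategy1 G) : Prop :=
  ∀ h x, ∃ a ∈ G.actA x, σ.play h x a = 1

/-- A pure strategy of player 2. -/
def Strategy2.pure (τ : Strategy2 G) : Prop :=
  ∀ h x, ∃ b ∈ G.actB x, τ.play h x b = 1

variable (G)

/-- Auxiliary function: the probability of a finite history, the past history being
given in reverse chronological order. -/
def histProbAux (x₁ : G.X) (σ : Strategy1 G) (τ : Strategy2 G) :
    List (G.X × G.A × G.B) → G.X → ℝ
  | [], x => if x = x₁ then 1 else 0
  | (y, a, b) :: rest, x =>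
      histProbAux x₁ σ τ rest y * σ.play rest.reverse y a * τ.play rest.reverse y b *
        G.q y a b x

/-- Probability, in the game starting at `x₁` played with `(σ, τ)`, that the play starts
with the (chronological) past history `h` followed by the current state `x`. -/
def histProb (x₁ : G.X) (σ : Strategy1 G) (τ : Strategy2 G)
    (h : List (G.X × G.A × G.B)) (x : G.X) : ℝ :=
  G.histProbAux x₁ σ τ h.reverse x

/-- Expected payoff of stage `t` in the game starting at `x₁` played with `(σ, τ)`. -/
def stagePayoff (x₁ : G.X) (σ : Strategy1 G) (τ : Strategy2 G) (t : ℕ) : ℝ :=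
  ∑' hx : List (G.X × G.A × G.B) × G.X,
    if hx.1.length + 1 = t then
      G.histProb x₁ σ τ hx.1 hx.2 *
        ∑ a ∈ G.actA hx.2, ∑ b ∈ G.actB hx.2,
          σ.play hx.1 hx.2 a * τ.play hx.1 hx.2 b * G.g hx.2 a b
    else 0

/-- Expected average payoff `γ_n(x₁, σ, τ)` over the `n` first stages. -/
def avgPayoff (x₁ : G.X) (σ : Strategy1 G) (τ : Strategy2 G) (n : ℕ) : ℝ :=
  (n : ℝ)⁻¹ * ∑ t ∈ Finset.Icc 1 n, G.stagePayoff x₁ σ τ t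

/-- Expected `λ`-discounted payoff `γ_λ(x₁, σ, τ)`. -/
def discPayoff (x₁ : G.X) (σ : Strategy1 G) (τ : Strategy2 G) (lam : ℝ) : ℝ :=
  ∑' t : ℕ, lam * (1 - lam) ^ t * G.stagePayoff x₁ σ τ (t + 1)

/-- The value `v_n(x₁)` of the `n`-stage game (by the minmax theorem, the game has a
value, which is then equal to this maxmin). -/
def nValue (n : ℕ) (x₁ : G.X) : ℝ :=
  ⨆ σ : Strategy1 G, ⨅ τ : Strategy2 G, G.avgPayoff x₁ σ τ n

/-- The value `v_λ(x₁)` of the `λ`-discounted game. -/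
def lamValue (lam : ℝ) (x₁ : G.X) : ℝ :=
  ⨆ σ : Strategy1 G, ⨅ τ : Strategy2 G, G.discPayoff x₁ σ τ lam

/-- The pointwise limit superior `v(x) = limsup_n v_n(x)` of the `n`-stage values. -/
def limsupV (x : G.X) : ℝ := Filter.limsup (fun n => G.nValue n x) Filter.atTop

/-- The family `{v_n, n ≥ 1}` is totally bounded for the uniform norm: for every
`ε > 0` there is a finite subfamily within uniform distance `ε` of every member. -/
def TotallyBoundedValues : Prop :=
  ∀ ε > (0 : ℝ), ∃ S : Finset ℕ, (∀ m ∈ S, 1 ≤ m) ∧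
    ∀ n, 1 ≤ n → ∃ m ∈ S, ∀ x, |G.nValue n x - G.nValue m x| ≤ ε

/-- Probability that the sequence of the first states of the play is `s`. -/
def statesProb (x₁ : G.X) (σ : Strategy1 G) (τ : Strategy2 G) (s : List G.X) : ℝ :=
  ∑' hx : List (G.X × G.A × G.B) × G.X,
    if stateSeq hx = s then G.histProb x₁ σ τ hx.1 hx.2 else 0

end StocGame

/-- A two-player zero-sum recursive game: a stochastic game whose state space is
partitioned into active states (where the payoff is `0`) and absorbing states (which
are trapping, with a payoff depending only on the state). -/
structure RecGame extends StocGame where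
  absorbing : X → Prop
  g_active : ∀ x a b, ¬ absorbing x → g x a b = 0
  absorbing_q : ∀ x a b, absorbing x → q x a b x = 1
  absorbing_g : ∀ x a b a' b', absorbing x → g x a b = g x a' b'

namespace RecGame

variable (G : RecGame)

/-- The stage payoff as a function of the state only: `0` on active states, and the
absorbing payoff on absorbing states. -/
def stateg (x : G.X) : ℝ :=
  G.g x (G.actA_nonempty x).choose (G.actB_nonempty x).choose

/-- Probability that the play is absorbed within the first `N` stages; since absorbing
states are trapping this is the probability that the state of stage `N` is absorbing,
i.e. `P(ρ ≤ N)` where `ρ` is the absorption time. -/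
def absorbedProb (x₁ : G.X) (σ : G.toStocGame.Strategy1) (τ : G.toStocGame.Strategy2)
    (N : ℕ) : ℝ :=
  ∑' hx : List (G.X × G.A × G.B) × G.X,
    if hx.1.length + 1 = N ∧ G.absorbing hx.2 then
      G.toStocGame.histProb x₁ σ τ hx.1 hx.2 else 0

/-- A uniformly terminating strategy of player 1. -/
def UniformlyTerminating1 (σ : G.toStocGame.Strategy1) : Prop :=
  ∀ ε > (0 : ℝ), ∃ N : ℕ, 1 ≤ N ∧ ∀ x₁, ¬ G.absorbing x₁ →
    ∀ τ, G.absorbedProb x₁ σ τ N ≥ 1 - ε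

end RecGame

/-- If every uniform bound `D` of a bounded function improves to `θ * D + c` with `θ ≤ 1`,
then `(1 - θ)` times the function is bounded by `c`. -/
theorem one_sub_mul_abs_le {X : Type*} (u : X → ℝ) {C θ c : ℝ} (hθ : θ ≤ 1)
    (hC : ∀ x, |u x| ≤ C)
    (h : ∀ D, (∀ x, |u x| ≤ D) → ∀ x, |u x| ≤ θ * D + c) (x : X) :
    (1 - θ) * |u x| ≤ c := by
  have hb : BddAbove (Set.range fun x => |u x|) := ⟨C, by rintro _ ⟨y, rfl⟩; exact hC y⟩
  have hle : ∀ y, |u y| ≤ ⨆ x, |u x| := fun y => le_ciSup hb y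
  have : Nonempty X := ⟨x⟩
  have hD : (⨆ x, |u x|) ≤ θ * (⨆ x, |u x|) + c := ciSup_le (h _ hle)
  nlinarith [hle x]

theorem one_sub_pow_mul_one_add_le_one {l : ℝ} (h0 : 0 ≤ l) (h1 : l ≤ 1) (n : ℕ) :
    (1 - l) ^ n * (1 + n * l) ≤ 1 := by
  have hb : 1 + n * l ≤ (1 + l) ^ n := one_add_mul_le_pow (by linarith) n
  calc (1 - l) ^ n * (1 + n * l) ≤ (1 - l) ^ n * (1 + l) ^ n :=
        mul_le_mul_of_nonneg_left hb (pow_nonneg (by linarith) n)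
    _ = (1 - l ^ 2) ^ n := by rw [← mul_pow]; ring
    _ ≤ 1 := pow_le_one₀ (by nlinarith) (by nlinarith)

theorem one_sub_mul_le_one_sub_pow {l : ℝ} (h1 : l ≤ 1) (n : ℕ) :
    1 - n * l ≤ (1 - l) ^ n := by
  have := one_add_mul_le_pow (a := -l) (by linarith) n
  calc 1 - n * l = 1 + n * (-l) := by ring
    _ ≤ (1 + -l) ^ n := this
    _ = (1 - l) ^ n := by ring

/-- The properties of a Shapley operator `S` (where `S α f` has stage payoffs weighted by `α`
and continuation payoff `f`) and of the associated averaged values `v` and discounted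
values `w` which are needed for the Tauberian theorem. -/
structure IsShapleySystem {X : Type*} (S : ℝ → (X → ℝ) → X → ℝ) (v : ℕ → X → ℝ)
    (w : ℝ → X → ℝ) : Prop where
  lipschitz : ∀ {α β : ℝ} {f h : X → ℝ} {C D : ℝ}, (∀ y, |f y| ≤ C) → (∀ y, |h y| ≤ C) →
    (∀ y, |f y - h y| ≤ D) → ∀ x, |S α f x - S β h x| ≤ |α - β| + D
  homogeneous : ∀ {c : ℝ}, 0 ≤ c → ∀ (α : ℝ) (f : X → ℝ) (x : X),
    S (c * α) (fun y => c * f y) x = c * S α f x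
  avg_abs_le : ∀ n x, |v n x| ≤ 1
  disc_abs_le : ∀ {l : ℝ}, 0 < l → l ≤ 1 → ∀ x, |w l x| ≤ 1
  avg_rec : ∀ (n : ℕ) (x : X), ((n : ℝ) + 1) * v (n + 1) x = S 1 (fun y => n * v n y) x
  disc_rec : ∀ {l : ℝ}, 0 < l → l ≤ 1 → ∀ x, w l x = S l (fun y => (1 - l) * w l y) x

namespace IsShapleySystem

variable {X : Type*} {S : ℝ → (X → ℝ) → X → ℝ} {v : ℕ → X → ℝ} {w : ℝ → X → ℝ}

theorem disc_sub_scaled_avg_le (H : IsShapleySystem S v w) {m : ℕ} {l D : ℝ}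
    (hl0 : 0 < l) (hl1 : l ≤ 1) (hml : m * l = 1) (hD : ∀ x, |w l x - v m x| ≤ D)
    (n : ℕ) (x : X) :
    |w l x - (1 - l) ^ n * l * ((m + n : ℕ) * v (m + n) x)| ≤
      (1 - l) ^ n * D + (n * l) ^ 2 := by
  induction n generalizing x with
  | zero =>
    have : (1 - l) ^ 0 * l * ((m + 0 : ℕ) * v (m + 0) x) = v m x := by
      rw [add_zero, pow_zero, one_mul, ← mul_assoc, mul_comm l, hml, one_mul]
    rw [this]
    simpa using hD x
  | succ n ih =>
    set c := (1 - l) ^ (n + 1) with hc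
    have hl1' : 0 ≤ 1 - l := by linarith
    have hc0 : 0 ≤ c := pow_nonneg hl1' _
    have hc1 : 1 - ((n : ℝ) + 1) * l ≤ c := by
      have := one_sub_mul_le_one_sub_pow hl1 (n + 1)
      push_cast at this; exact this
    have hc2 : c ≤ 1 := pow_le_one₀ hl1' (by linarith)
    have hrec : c * l * ((m + (n + 1) : ℕ) * v (m + (n + 1)) x) =
        S (c * l) (fun y => c * l * ((m + n : ℕ) * v (m + n) y)) x := by
      have h1 := H.avg_rec (m + n) x
      have h2 := H.homogeneous (mul_nonneg hc0 hl0.le) 1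
        (fun y => ((m + n : ℕ) : ℝ) * v (m + n) y) x
      rw [mul_one] at h2
      rw [h2, ← h1, ← add_assoc]
      push_cast
      ring
    rw [hrec, H.disc_rec hl0 hl1 x]
    have hb1 : ∀ y, |(1 - l) * w l y| ≤ 1 + (m + n : ℕ) := fun y => by
      rw [abs_mul, abs_of_nonneg hl1']
      have := H.disc_abs_le hl0 hl1 y
      have h3 : (0 : ℝ) ≤ (m + n : ℕ) := Nat.cast_nonneg _
      nlinarith [abs_nonneg (w l y)]
    have hb2 : ∀ y, |c * l * ((m + n : ℕ) * v (m + n) y)| ≤ 1 + (m + n : ℕ) := fun y => by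
      have h3 : (0 : ℝ) ≤ (m + n : ℕ) := Nat.cast_nonneg _
      rw [abs_mul, abs_mul ((m + n : ℕ) : ℝ), abs_of_nonneg (mul_nonneg hc0 hl0.le),
        abs_of_nonneg h3]
      have h4 := H.avg_abs_le (m + n) y
      have h5 : c * l ≤ 1 := mul_le_one₀ hc2 hl0.le hl1
      have h6 : ((m + n : ℕ) : ℝ) * |v (m + n) y| ≤ (m + n : ℕ) := mul_le_of_le_one_right h3 h4
      have h7 : c * l * (((m + n : ℕ) : ℝ) * |v (m + n) y|) ≤ 1 * (m + n : ℕ) :=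
        mul_le_mul h5 h6 (by positivity) zero_le_one
      linarith
    have hdiff : ∀ y, |(1 - l) * w l y - c * l * ((m + n : ℕ) * v (m + n) y)| ≤
        (1 - l) * ((1 - l) ^ n * D + (n * l) ^ 2) := fun y => by
      have : (1 - l) * w l y - c * l * ((m + n : ℕ) * v (m + n) y) =
          (1 - l) * (w l y - (1 - l) ^ n * l * ((m + n : ℕ) * v (m + n) y)) := by
        rw [hc, pow_succ]; ring
      rw [this, abs_mul, abs_of_nonneg hl1']
      exact mul_le_mul_of_nonneg_left (ih y) hl1'
    refine (H.lipschitz hb1 hb2 hdiff x).trans ?_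
    have habs : |l - c * l| ≤ (n + 1) * l * l := by
      rw [abs_of_nonneg (by nlinarith)]
      nlinarith
    have hexp : (1 - l) * ((1 - l) ^ n * D + (n * l) ^ 2) ≤ c * D + (n * l) ^ 2 := by
      have : (1 - l) * ((1 - l) ^ n * D) = c * D := by rw [hc, pow_succ]; ring
      nlinarith [sq_nonneg ((n : ℝ) * l)]
    push_cast
    nlinarith [sq_nonneg l, mul_nonneg (Nat.cast_nonneg (α := ℝ) n) (sq_nonneg l)]

/-- The distance between the discounted value and the averaged value contracts when the
horizon is lengthened from `m` to `m + n` stages, up to an error of second order in `n / m`. -/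
theorem disc_sub_avg_le (H : IsShapleySystem S v w) {m : ℕ} {l D : ℝ}
    (hl0 : 0 < l) (hl1 : l ≤ 1) (hml : m * l = 1) (hD : ∀ x, |w l x - v m x| ≤ D)
    (n : ℕ) (x : X) :
    |w l x - v (m + n) x| ≤ (1 - l) ^ n * D + 2 * (n * l) ^ 2 := by
  have h1 := H.disc_sub_scaled_avg_le hl0 hl1 hml hD n x
  have h2 := one_sub_pow_mul_one_add_le_one hl0.le hl1 n
  have h3 := one_sub_mul_le_one_sub_pow hl1 n
  have h0 : (0 : ℝ) ≤ n * l := by positivity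
  have h4 : 1 - (n * l) ^ 2 ≤ (1 - l) ^ n * (1 + n * l) := by nlinarith
  have h5 : (1 - l) ^ n * l * ((m + n : ℕ) * v (m + n) x) =
      (1 - l) ^ n * (1 + n * l) * v (m + n) x := by
    push_cast
    linear_combination (1 - l) ^ n * v (m + n) x * hml
  rw [h5] at h1
  have h6 : |(1 - l) ^ n * (1 + n * l) * v (m + n) x - v (m + n) x| ≤ (n * l) ^ 2 := by
    have : (1 - l) ^ n * (1 + n * l) * v (m + n) x - v (m + n) x =
      ((1 - l) ^ n * (1 + n * l) - 1) * v (m + n) x := by ring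
    rw [this, abs_mul]
    have h7 : |(1 - l) ^ n * (1 + n * l) - 1| ≤ (n * l) ^ 2 := by
      rw [abs_le]; constructor <;> linarith [sq_nonneg ((n : ℝ) * l)]
    exact (mul_le_of_le_one_right (abs_nonneg _) (H.avg_abs_le _ x)).trans h7
  have := abs_sub_le (w l x) ((1 - l) ^ n * (1 + n * l) * v (m + n) x) (v (m + n) x)
  linarith

theorem disc_sub_disc_le (H : IsShapleySystem S v w) {l μ : ℝ}
    (hl1 : l ≤ 1) (hμ0 : 0 < μ) (hμl : μ ≤ l) (x : X) :
    l * |w l x - w μ x| ≤ 2 * (l - μ) := by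
  have hl0 : 0 < l := hμ0.trans_le hμl
  have key := one_sub_mul_abs_le (fun x => w l x - w μ x) (C := 2) (θ := 1 - l)
    (c := 2 * (l - μ)) (by linarith)
    (fun x => (abs_sub _ _).trans (by
      linarith [H.disc_abs_le hl0 hl1 x, H.disc_abs_le hμ0 (hμl.trans hl1) x])) ?_ x
  · simpa using key
  intro D hD x
  have hb : ∀ {ν : ℝ}, 0 < ν → ν ≤ 1 → ∀ y, |(1 - ν) * w ν y| ≤ 1 := fun {ν} h0 h1 y => by
    rw [abs_mul, abs_of_nonneg (by linarith)]
    nlinarith [H.disc_abs_le h0 h1 y, abs_nonneg (w ν y)]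
  have hd : ∀ y, |(1 - l) * w l y - (1 - μ) * w μ y| ≤ (1 - l) * D + (l - μ) := fun y => by
    have : (1 - l) * w l y - (1 - μ) * w μ y =
      (1 - l) * (w l y - w μ y) + (l - μ) * (- w μ y) := by ring
    rw [this]
    refine (abs_add_le _ _).trans ?_
    rw [abs_mul, abs_mul, abs_neg, abs_of_nonneg (by linarith : 0 ≤ 1 - l),
      abs_of_nonneg (by linarith : 0 ≤ l - μ)]
    have h1 := H.disc_abs_le hμ0 (hμl.trans hl1) y
    have h2 : (1 - l) * |w l y - w μ y| ≤ (1 - l) * D :=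
      mul_le_mul_of_nonneg_left (hD y) (by linarith)
    nlinarith
  have := H.lipschitz (α := l) (β := μ) (hb hl0 hl1) (hb hμ0 (hμl.trans hl1)) hd x
  rw [← H.disc_rec hl0 hl1, ← H.disc_rec hμ0 (hμl.trans hl1),
    abs_of_nonneg (by linarith : 0 ≤ l - μ)] at this
  linarith

set_option maxHeartbeats 1000000 in
/-- Uniform convergence of the averaged values implies uniform convergence of the
discounted values to the same limit. -/
theorem disc_tendsto (H : IsShapleySystem S v w) {u : X → ℝ}
    (hu : ∀ ε > (0 : ℝ), ∃ N : ℕ, ∀ n ≥ N, ∀ x, |v n x - u x| ≤ ε) :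
    ∀ ε > (0 : ℝ), ∃ δ > (0 : ℝ), ∀ l : ℝ, 0 < l → l ≤ 1 → l ≤ δ → ∀ x,
      |w l x - u x| ≤ ε := by
  intro ε hε
  obtain ⟨k, hk⟩ := exists_nat_gt (16 / ε + 1)
  have hk1 : (1 : ℝ) < k := by have : 0 < 16 / ε := by positivity
                               linarith
  have hk0 : (0 : ℝ) < k := by linarith
  have hkε : 16 < k * ε := by
    have : 16 / ε < k := by linarith
    rwa [div_lt_iff₀ hε] at this
  obtain ⟨N, hN⟩ := hu (ε / (64 * k)) (by positivity)
  refine ⟨min (1 / ((N : ℝ) + k)) (ε / 16), lt_min (by positivity) (by positivity), ?_⟩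
  intro l hl0 hl1 hlδ x
  have hlN : l * (N + k) ≤ 1 := by
    have := hlδ.trans (min_le_left _ _)
    rwa [le_div_iff₀ (by positivity)] at this
  have hlε : l ≤ ε / 16 := hlδ.trans (min_le_right _ _)
  -- replace `l` by the inverse `μ` of an integer `m`
  set m := ⌈1 / l⌉₊ with hm
  have hm1 : 1 / l ≤ m := Nat.le_ceil _
  have hm2 : (m : ℝ) < 1 / l + 1 := Nat.ceil_lt_add_one (by positivity)
  have hNkm : (N : ℝ) + k ≤ m := le_trans (by rwa [le_div_iff₀ hl0, mul_comm]) hm1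
  have hm0 : (0 : ℝ) < m := lt_of_lt_of_le (by positivity) hNkm
  have hNk : N + k ≤ m := by exact_mod_cast hNkm
  set μ := 1 / (m : ℝ) with hμ
  have hμ0 : 0 < μ := by positivity
  have hmμ : (m : ℝ) * μ = 1 := by rw [hμ]; field_simp
  have hlm : 1 ≤ m * l := by rwa [div_le_iff₀ hl0] at hm1
  have hml1 : m * l < 1 + l := by
    have : m * l < (1 / l + 1) * l := mul_lt_mul_of_pos_right hm2 hl0
    rwa [add_mul, one_div, inv_mul_cancel₀ hl0.ne', one_mul] at this
  have hμl : μ ≤ l := by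
    rw [hμ, div_le_iff₀ hm0]; linarith
  have hμ1 : μ ≤ 1 := hμl.trans hl1
  have hlμ : l - μ ≤ l * l := by
    have : l - μ = (m * l - 1) * μ := by linear_combination -l * hmμ
    rw [this]
    exact mul_le_mul (by linarith) hμl hμ0.le hl0.le
  have hA : |w l x - w μ x| ≤ ε / 8 := by
    have := H.disc_sub_disc_le hl1 hμ0 hμl x
    have h2 : l * |w l x - w μ x| ≤ l * (ε / 8) := by nlinarith
    exact le_of_mul_le_mul_left h2 hl0
  -- the block length
  set n := m / k with hn
  have hkpos : 0 < k := by exact_mod_cast hk0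
  have hnk : n * k ≤ m := Nat.div_mul_le_self m k
  have hnk_lt : m < n * k + k := by
    have := Nat.lt_div_mul_add (a := m) hkpos
    simpa [hn] using this
  have hn1 : 1 ≤ n := by
    rw [hn]; exact (Nat.one_le_div_iff hkpos).2 (by omega)
  have hm_nk : m ≤ 2 * (n * k) := by nlinarith
  set s := (n : ℝ) * μ with hs
  have hnkR : (n : ℝ) * k ≤ m := by exact_mod_cast hnk
  have hmR : (m : ℝ) ≤ 2 * (n * k) := by exact_mod_cast hm_nk
  have hsk : s * k ≤ 1 := by
    calc s * k = (n * k) * μ := by rw [hs]; ring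
      _ ≤ m * μ := mul_le_mul_of_nonneg_right hnkR hμ0.le
      _ = 1 := hmμ
  have hsk2 : 1 ≤ 2 * (s * k) := by
    calc (1 : ℝ) = m * μ := hmμ.symm
      _ ≤ 2 * (n * k) * μ := mul_le_mul_of_nonneg_right hmR hμ0.le
      _ = 2 * (s * k) := by rw [hs]; ring
  have hs0 : 0 < s := by
    have : (0 : ℝ) < n := by exact_mod_cast hn1
    positivity
  have hs1 : s ≤ 1 := by nlinarith
  have hpow : (1 - μ) ^ n ≤ 1 - s / 2 := by
    have h1 := one_sub_pow_mul_one_add_le_one hμ0.le hμ1 n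
    have h2 : 0 ≤ (1 - μ) ^ n := pow_nonneg (by linarith) n
    have h3 : 1 ≤ (1 - s / 2) * (1 + s) := by nlinarith
    exact le_of_mul_le_mul_right (h1.trans h3) (by linarith)
  have hNm : N ≤ m := by omega
  have hB : s / 2 * |w μ x - v m x| ≤ 2 * s ^ 2 + ε / (32 * k) := by
    have key := one_sub_mul_abs_le (fun x => w μ x - v m x) (C := 2) (θ := 1 - s / 2)
      (c := 2 * s ^ 2 + ε / (32 * k)) (by linarith)
      (fun x => (abs_sub _ _).trans (by
        linarith [H.disc_abs_le hμ0 hμ1 x, H.avg_abs_le m x])) ?_ x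
    · simpa using key
    intro D hD y
    have h1 := H.disc_sub_avg_le hμ0 hμ1 hmμ hD n y
    have hD0 : 0 ≤ D := (abs_nonneg _).trans (hD y)
    have h2 : (1 - μ) ^ n * D ≤ (1 - s / 2) * D := mul_le_mul_of_nonneg_right hpow hD0
    have h3 := hN (m + n) (by omega) y
    have h4 := hN m hNm y
    have h5 : ε / (64 * k) + ε / (64 * k) = ε / (32 * k) := by field_simp; norm_num
    have h6 := abs_sub_le (w μ y) (v (m + n) y) (v m y)
    have h7 := abs_sub_le (v (m + n) y) (u y) (v m y)
    rw [abs_sub_comm (u y)] at h7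
    linarith
  have hC : |w μ x - v m x| ≤ ε / 2 := by
    have h1 : ε / (32 * k) ≤ s * (ε / 16) := by
      rw [div_le_iff₀ (by positivity)]
      nlinarith
    have h2 : 4 * s ≤ ε / 4 := by nlinarith
    have h3 : s * |w μ x - v m x| ≤ s * (ε / 2) := by nlinarith
    exact le_of_mul_le_mul_left h3 hs0
  have hE : |v m x - u x| ≤ ε / 8 := by
    refine (hN m hNm x).trans ?_
    rw [div_le_div_iff₀ (by positivity) (by norm_num)]
    nlinarith
  have h1 := abs_sub_le (w l x) (w μ x) (u x)
  have h2 := abs_sub_le (w μ x) (v m x) (u x)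
  linarith

set_option maxHeartbeats 1000000 in
/-- Uniform convergence of the discounted values implies uniform convergence of the
averaged values to the same limit. -/
theorem avg_tendsto (H : IsShapleySystem S v w) {u : X → ℝ}
    (hu : ∀ ε > (0 : ℝ), ∃ δ > (0 : ℝ), ∀ l : ℝ, 0 < l → l ≤ 1 → l ≤ δ → ∀ x,
      |w l x - u x| ≤ ε) :
    ∀ ε > (0 : ℝ), ∃ N : ℕ, ∀ n ≥ N, ∀ x, |v n x - u x| ≤ ε := by
  intro ε hε
  obtain ⟨k, hk⟩ := exists_nat_gt (64 / ε + 2)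
  have hk2 : (2 : ℝ) < k := by have : 0 < 64 / ε := by positivity
                               linarith
  have hk0 : (0 : ℝ) < k := by linarith
  have hkε : 64 < k * ε := by
    have : 64 / ε < k := by linarith
    rwa [div_lt_iff₀ hε] at this
  have hkpos : 0 < k := by exact_mod_cast hk0
  have hk2' : 2 < k := by exact_mod_cast hk2
  obtain ⟨δ, hδ, hW⟩ := hu (ε / (16 * k)) (by positivity)
  obtain ⟨N, hN⟩ := exists_nat_gt (2 / δ + 2 * k)
  have hNδ : 2 < N * δ := by
    have : 2 / δ < N := by linarith
    rwa [div_lt_iff₀ hδ] at this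
  have hNk : 2 * k < N := by
    have : 0 < 2 / δ := by positivity
    have : (2 : ℝ) * k < N := by linarith
    exact_mod_cast this
  set c := 8 / (k : ℝ) ^ 2 + ε / (8 * k) with hc
  have hc0 : 0 ≤ c := by positivity
  have main : ∀ M : ℕ, 1 ≤ M → ∀ x,
      M * |w (1 / M) x - v M x| ≤ 2 * N + 2 * k * c * M := by
    intro M
    induction M using Nat.strong_induction_on with
    | _ M ih =>
    intro hM x
    have hMR : (1 : ℝ) ≤ M := by exact_mod_cast hM
    have hb : |w (1 / M) x - v M x| ≤ 2 := by
      refine (abs_sub _ _).trans ?_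
      have := H.disc_abs_le (l := 1 / (M : ℝ)) (by positivity)
        (by rw [div_le_one (by linarith)]; exact hMR) x
      linarith [H.avg_abs_le M x]
    rcases lt_or_ge M N with hMN | hMN
    · have : (M : ℝ) ≤ N := by exact_mod_cast hMN.le
      have : 0 ≤ 2 * k * c * M := by positivity
      nlinarith
    · set n := M / k with hn
      obtain ⟨m, hm⟩ : ∃ m, M = m + n := ⟨M - n, by have := Nat.div_le_self M k; omega⟩
      have hnk : n * k ≤ M := Nat.div_mul_le_self M k
      have hnk_lt : M < n * k + k := by
        have := Nat.lt_div_mul_add (a := M) hkpos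
        simpa [hn] using this
      clear_value n
      have hM2 : M ≤ 2 * (n * k) := by omega
      have hn1 : 1 ≤ n := by
        by_contra h0
        have : n = 0 := by omega
        rw [this] at hM2; omega
      have h2n : 2 * n ≤ M := by nlinarith
      have hm1 : 1 ≤ m := by omega
      have hmR : (1 : ℝ) ≤ m := by exact_mod_cast hm1
      set μ := 1 / (m : ℝ) with hμ
      have hμ0 : 0 < μ := by positivity
      have hmμ : (m : ℝ) * μ = 1 := by rw [hμ]; field_simp
      have hμ1 : μ ≤ 1 := by rw [hμ, div_le_one (by linarith)]; exact hmR
      set s := (n : ℝ) * μ with hs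
      have hMR' : (M : ℝ) = m + n := by exact_mod_cast hm
      have hM2m : (M : ℝ) ≤ 2 * m := by
        have : M ≤ 2 * m := by omega
        exact_mod_cast this
      have hnkR : (n : ℝ) * k ≤ M := by exact_mod_cast hnk
      have hM2R : (M : ℝ) ≤ 2 * (n * k) := by exact_mod_cast hM2
      have hs0 : 0 ≤ s := by positivity
      have hsk : s * k ≤ 2 := by
        calc s * k = (n * k) * μ := by rw [hs]; ring
          _ ≤ (2 * m) * μ := mul_le_mul_of_nonneg_right (hnkR.trans hM2m) hμ0.le
          _ = 2 := by rw [mul_assoc, hmμ, mul_one]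
      have hs2 : 2 * s ^ 2 ≤ 8 / (k : ℝ) ^ 2 := by
        rw [le_div_iff₀ (by positivity)]
        have : (s * k) ^ 2 ≤ 2 ^ 2 := pow_le_pow_left₀ (by positivity) hsk 2
        nlinarith
      have hD := ih m (by omega) hm1
      have hD' : ∀ y, |w μ y - v m y| ≤ μ * (2 * N + 2 * k * c * m) := fun y => by
        have := mul_le_mul_of_nonneg_left (hD y) hμ0.le
        rwa [← mul_assoc, mul_comm μ, hmμ, one_mul] at this
      have h1 := H.disc_sub_avg_le hμ0 hμ1 hmμ hD' n x
      rw [← hm] at h1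
      have hNM : (N : ℝ) ≤ M := by exact_mod_cast hMN
      have hμδ : μ ≤ δ := by
        rw [hμ, div_le_iff₀ (by linarith)]
        nlinarith
      have hMδ : 1 / (M : ℝ) ≤ δ := by
        rw [div_le_iff₀ (by linarith)]
        nlinarith
      have hM1 : 1 / (M : ℝ) ≤ 1 := by rw [div_le_one (by linarith)]; exact hMR
      have h2 := hW μ hμ0 hμ1 hμδ x
      have h3 := hW (1 / M) (by positivity) hM1 hMδ x
      have h4 := abs_sub_le (w (1 / M) x) (w μ x) (v M x)
      have h5 := abs_sub_le (w (1 / M) x) (u x) (w μ x)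
      rw [abs_sub_comm (u x)] at h5
      have h6 : ε / (16 * k) + ε / (16 * k) = ε / (8 * k) := by field_simp; norm_num
      have hpow := one_sub_pow_mul_one_add_le_one hμ0.le hμ1 n
      have h7 : M * ((1 - μ) ^ n * (μ * (2 * N + 2 * k * c * m))) ≤ 2 * N + 2 * k * c * m := by
        have : M * ((1 - μ) ^ n * (μ * (2 * N + 2 * k * c * m))) =
            (1 - μ) ^ n * (1 + n * μ) * (2 * N + 2 * k * c * m) := by
          rw [hMR']
          linear_combination (1 - μ) ^ n * (2 * N + 2 * k * c * m) * hmμ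
        rw [this]
        exact mul_le_of_le_one_left (by positivity) hpow
      have h8 : |w (1 / M) x - v M x| ≤
          (1 - μ) ^ n * (μ * (2 * N + 2 * k * c * m)) + c := by linarith
      have h9 : M * |w (1 / M) x - v M x| ≤
          M * ((1 - μ) ^ n * (μ * (2 * N + 2 * k * c * m)) + c) :=
        mul_le_mul_of_nonneg_left h8 (by linarith)
      have h10 : M * c ≤ 2 * (n * k) * c := mul_le_mul_of_nonneg_right hM2R hc0
      rw [hMR'] at h7 h9 h10 ⊢
      linarith
  obtain ⟨N', hN'⟩ := exists_nat_gt (8 * N / ε)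
  have hN'ε : 8 * N < N' * ε := by rwa [div_lt_iff₀ hε] at hN'
  refine ⟨max N N', fun M hM x => ?_⟩
  have hNM : N ≤ M := (le_max_left _ _).trans hM
  have hNMR : (N : ℝ) ≤ M := by exact_mod_cast hNM
  have hNMR' : (N' : ℝ) ≤ M := by exact_mod_cast (le_max_right _ _).trans hM
  have hM1 : 1 ≤ M := by omega
  have hMR : (1 : ℝ) ≤ M := by exact_mod_cast hM1
  have h1 := main M hM1 x
  have hMδ : 1 / (M : ℝ) ≤ δ := by
    rw [div_le_iff₀ (by linarith)]
    nlinarith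
  have hM1' : 1 / (M : ℝ) ≤ 1 := by rw [div_le_one (by linarith)]; exact hMR
  have h3 := hW (1 / M) (by positivity) hM1' hMδ x
  have h4 : 2 * k * c ≤ ε / 2 := by
    have : 2 * k * c = 16 / k + ε / 4 := by rw [hc]; field_simp; ring
    rw [this]
    have : 16 / (k : ℝ) ≤ ε / 4 := by
      rw [div_le_div_iff₀ hk0 (by norm_num)]; linarith
    linarith
  have h5 : M * |w (1 / M) x - v M x| ≤ M * (3 * ε / 4) := by nlinarith
  have h6 : |w (1 / M) x - v M x| ≤ 3 * ε / 4 := le_of_mul_le_mul_left h5 (by linarith)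
  have h7 : ε / (16 * k) ≤ ε / 4 := by
    rw [div_le_div_iff₀ (by positivity) (by norm_num)]
    nlinarith
  have h8 := abs_sub_le (v M x) (w (1 / M) x) (u x)
  rw [abs_sub_comm (v M x) (w _ x)] at h8
  linarith

end IsShapleySystem

section maxmin

variable {I J : Type*}

theorem bddBelow_of_abs_le {u : J → ℝ} {C : ℝ} (h : ∀ j, |u j| ≤ C) :
    BddBelow (Set.range u) :=
  ⟨-C, by rintro _ ⟨j, rfl⟩; exact (abs_le.1 (h j)).1⟩

theorem bddAbove_of_abs_le {u : J → ℝ} {C : ℝ} (h : ∀ j, |u j| ≤ C) :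
    BddAbove (Set.range u) :=
  ⟨C, by rintro _ ⟨j, rfl⟩; exact (abs_le.1 (h j)).2⟩

theorem abs_iInf_le [Nonempty J] {u : J → ℝ} {C : ℝ} (h : ∀ j, |u j| ≤ C) : |⨅ j, u j| ≤ C := by
  have j := Classical.arbitrary J
  exact abs_le.2 ⟨le_ciInf fun j => (abs_le.1 (h j)).1,
    (ciInf_le (bddBelow_of_abs_le h) j).trans (abs_le.1 (h j)).2⟩

theorem abs_iSup_le [Nonempty J] {u : J → ℝ} {C : ℝ} (h : ∀ j, |u j| ≤ C) : |⨆ j, u j| ≤ C := by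
  have j := Classical.arbitrary J
  exact abs_le.2 ⟨(abs_le.1 (h j)).1.trans (le_ciSup (bddAbove_of_abs_le h) j),
    ciSup_le fun j => (abs_le.1 (h j)).2⟩

theorem iSup_iInf_le_add [Nonempty I] [Nonempty J] {K K' : I → J → ℝ} {C E : ℝ} (hK : ∀ i j, |K i j| ≤ C)
    (hK' : ∀ i j, |K' i j| ≤ C) (h : ∀ i j, K i j ≤ K' i j + E) :
    (⨆ i, ⨅ j, K i j) ≤ (⨆ i, ⨅ j, K' i j) + E := by
  refine ciSup_le fun i => ?_
  have h1 : (⨅ j, K i j) - E ≤ ⨅ j, K' i j :=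
    le_ciInf fun j => by
      linarith [ciInf_le (bddBelow_of_abs_le (hK i)) j, h i j]
  have h2 : (⨅ j, K' i j) ≤ ⨆ i, ⨅ j, K' i j :=
    le_ciSup (f := fun i => ⨅ j, K' i j) (bddAbove_of_abs_le fun i => abs_iInf_le (hK' i)) i
  linarith

end maxmin

/-- Mixed actions on a finite set of feasible actions. -/
def MixedAction {α : Type*} (s : Finset α) : Type _ :=
  {p : α → ℝ // (∀ a, 0 ≤ p a) ∧ (∀ a, a ∉ s → p a = 0) ∧ ∑ a ∈ s, p a = 1}

theorem MixedAction.nonempty {α : Type*} {s : Finset α} (hs : s.Nonempty) :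
    Nonempty (MixedAction s) := by
  obtain ⟨a, ha⟩ := hs
  refine ⟨⟨fun b => if b = a then 1 else 0, fun b => ?_, fun b hb => ?_, ?_⟩⟩
  · dsimp only
    split_ifs <;> norm_num
  · exact if_neg (by rintro rfl; exact hb ha)
  · simp [ha]

namespace StocGame

variable {G : StocGame}

instance (x : G.X) : Nonempty (MixedAction (G.actA x)) :=
  MixedAction.nonempty (G.actA_nonempty x)

instance (x : G.X) : Nonempty (MixedAction (G.actB x)) :=
  MixedAction.nonempty (G.actB_nonempty x)

/-- The mixed action played by a strategy after a given history. -/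
def Strategy1.mixed (σ : Strategy1 G) (h : List (G.X × G.A × G.B)) (x : G.X) :
    MixedAction (G.actA x) :=
  ⟨σ.play h x, σ.nonneg h x, σ.supp h x, σ.sum_one h x⟩

/-- The mixed action played by a strategy after a given history. -/
def Strategy2.mixed (τ : Strategy2 G) (h : List (G.X × G.A × G.B)) (x : G.X) :
    MixedAction (G.actB x) :=
  ⟨τ.play h x, τ.nonneg h x, τ.supp h x, τ.sum_one h x⟩

/-- The strategy induced after a first stage `e`. -/
def Strategy1.shift (σ : Strategy1 G) (e : G.X × G.A × G.B) : Strategy1 G where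
  play h := σ.play (e :: h)
  nonneg h := σ.nonneg (e :: h)
  supp h := σ.supp (e :: h)
  sum_one h := σ.sum_one (e :: h)

/-- The strategy induced after a first stage `e`. -/
def Strategy2.shift (τ : Strategy2 G) (e : G.X × G.A × G.B) : Strategy2 G where
  play h := τ.play (e :: h)
  nonneg h := τ.nonneg (e :: h)
  supp h := τ.supp (e :: h)
  sum_one h := τ.sum_one (e :: h)

/-- The initial state of a finite history. -/
def firstState : List (G.X × G.A × G.B) → G.X → G.X
  | [], x => x
  | e :: _, _ => e.1

/-- Play `r` at the first stage, then the strategy `T e y`, where `e` describes the first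
stage and `y` is the second state. -/
def Strategy1.concat (r : ∀ x, MixedAction (G.actA x))
    (T : G.X × G.A × G.B → G.X → Strategy1 G) : Strategy1 G where
  play
    | [], x => (r x).1
    | e :: h, x => (T e (firstState h x)).play h x
  nonneg h x := by cases h; exacts [(r x).2.1, Strategy1.nonneg _ _ _]
  supp h x := by cases h; exacts [(r x).2.2.1, Strategy1.supp _ _ _]
  sum_one h x := by cases h; exacts [(r x).2.2.2, Strategy1.sum_one _ _ _]

/-- Play `r` at the first stage, then the strategy `T e y`, where `e` describes the first
stage and `y` is the second state. -/
def Strategy2.concat (r : ∀ x, MixedAction (G.actB x))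
    (T : G.X × G.A × G.B → G.X → Strategy2 G) : Strategy2 G where
  play
    | [], x => (r x).1
    | e :: h, x => (T e (firstState h x)).play h x
  nonneg h x := by cases h; exacts [(r x).2.1, Strategy2.nonneg _ _ _]
  supp h x := by cases h; exacts [(r x).2.2.1, Strategy2.supp _ _ _]
  sum_one h x := by cases h; exacts [(r x).2.2.2, Strategy2.sum_one _ _ _]

instance : Nonempty (Strategy1 G) :=
  ⟨{  play := fun _ x => (Classical.arbitrary (MixedAction (G.actA x))).1
      nonneg := fun _ x => (Classical.arbitrary (MixedAction (G.actA x))).2.1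
      supp := fun _ x => (Classical.arbitrary (MixedAction (G.actA x))).2.2.1
      sum_one := fun _ x => (Classical.arbitrary (MixedAction (G.actA x))).2.2.2 }⟩

instance : Nonempty (Strategy2 G) :=
  ⟨{  play := fun _ x => (Classical.arbitrary (MixedAction (G.actB x))).1
      nonneg := fun _ x => (Classical.arbitrary (MixedAction (G.actB x))).2.1
      supp := fun _ x => (Classical.arbitrary (MixedAction (G.actB x))).2.2.1
      sum_one := fun _ x => (Classical.arbitrary (MixedAction (G.actB x))).2.2.2 }⟩

variable (G)

/-- The finite support of the transition. -/
def qSupp (x : G.X) (a : G.A) (b : G.B) : Finset G.X := (G.q_finsupp x a b).toFinset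

theorem sum_qSupp (x : G.X) (a : G.A) (b : G.B) : ∑ y ∈ G.qSupp x a b, G.q x a b y = 1 := by
  rw [← G.q_sum x a b, tsum_eq_sum]
  intro y hy
  simpa [qSupp] using hy

/-- Expected payoff of the one-shot game at `x` with stage payoff weighted by `α` and
continuation payoff `F`, when mixed actions `p` and `r` are played. -/
def oneShot (x : G.X) (p : MixedAction (G.actA x)) (r : MixedAction (G.actB x)) (α : ℝ)
    (F : G.A → G.B → G.X → ℝ) : ℝ :=
  ∑ a ∈ G.actA x, ∑ b ∈ G.actB x, p.1 a * r.1 b *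
    (α * G.g x a b + ∑ y ∈ G.qSupp x a b, G.q x a b y * F a b y)

theorem oneShot_le_add (x : G.X) (p : MixedAction (G.actA x)) (r : MixedAction (G.actB x))
    {α β D : ℝ} {F F' : G.A → G.B → G.X → ℝ} (h : ∀ a b y, F a b y ≤ F' a b y + D) :
    G.oneShot x p r α F ≤ G.oneShot x p r β F' + (|α - β| + D) := by
  have hone : ∑ a ∈ G.actA x, ∑ b ∈ G.actB x, p.1 a * r.1 b * (|α - β| + D) = |α - β| + D := by
    simp_rw [← Finset.sum_mul, ← Finset.mul_sum]
    rw [r.2.2.2, ← Finset.sum_mul, p.2.2.2]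
    ring
  rw [← hone, oneShot, oneShot, ← Finset.sum_add_distrib]
  refine Finset.sum_le_sum fun a _ => ?_
  rw [← Finset.sum_add_distrib]
  refine Finset.sum_le_sum fun b _ => ?_
  rw [← mul_add]
  refine mul_le_mul_of_nonneg_left ?_ (mul_nonneg (p.2.1 a) (r.2.1 b))
  have h1 : ∑ y ∈ G.qSupp x a b, G.q x a b y * F a b y ≤
      (∑ y ∈ G.qSupp x a b, G.q x a b y * F' a b y) + D := by
    calc ∑ y ∈ G.qSupp x a b, G.q x a b y * F a b y
        ≤ ∑ y ∈ G.qSupp x a b, G.q x a b y * (F' a b y + D) :=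
          Finset.sum_le_sum fun y _ => mul_le_mul_of_nonneg_left (h a b y) (G.q_nonneg x a b y)
      _ = (∑ y ∈ G.qSupp x a b, G.q x a b y * F' a b y) + D := by
          simp_rw [mul_add]
          rw [Finset.sum_add_distrib, ← Finset.sum_mul, sum_qSupp, one_mul]
  have h2 : (α - β) * G.g x a b ≤ |α - β| := by
    refine (le_abs_self _).trans ?_
    rw [abs_mul]
    exact mul_le_of_le_one_right (abs_nonneg _) (G.g_bdd x a b)
  linarith

theorem abs_oneShot_le (x : G.X) (p : MixedAction (G.actA x)) (r : MixedAction (G.actB x))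
    {α C : ℝ} {F : G.A → G.B → G.X → ℝ} (h : ∀ a b y, |F a b y| ≤ C) :
    |G.oneShot x p r α F| ≤ |α| + C := by
  have h0 : G.oneShot x p r 0 (fun _ _ _ => 0) = 0 := by simp [oneShot]
  have h1 := G.oneShot_le_add x p r (α := α) (β := 0) (D := C) (F := F)
    (F' := fun _ _ _ => 0) (fun a b y => by linarith [(abs_le.1 (h a b y)).2])
  have h2 := G.oneShot_le_add x p r (α := 0) (β := α) (D := C) (F := fun _ _ _ => 0)
    (F' := F) (fun a b y => by linarith [(abs_le.1 (h a b y)).1])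
  rw [h0] at h1 h2
  rw [sub_zero] at h1
  rw [zero_sub, abs_neg] at h2
  exact abs_le.2 ⟨by linarith, by linarith⟩

/-- The Shapley operator (in maxmin form), with stage payoff weighted by `α`. -/
def shapley (α : ℝ) (f : G.X → ℝ) (x : G.X) : ℝ :=
  ⨆ p : MixedAction (G.actA x), ⨅ r : MixedAction (G.actB x),
    G.oneShot x p r α (fun _ _ y => f y)

theorem shapley_le_add {α β C D : ℝ} {f h : G.X → ℝ} (hf : ∀ y, |f y| ≤ C)
    (hh : ∀ y, |h y| ≤ C) (hfh : ∀ y, f y ≤ h y + D) (x : G.X) :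
    G.shapley α f x ≤ G.shapley β h x + (|α - β| + D) := by
  refine iSup_iInf_le_add (C := max |α| |β| + C) (fun p r => ?_) (fun p r => ?_) (fun p r => ?_)
  · exact (G.abs_oneShot_le x p r fun _ _ y => hf y).trans (by gcongr; exact le_max_left _ _)
  · exact (G.abs_oneShot_le x p r fun _ _ y => hh y).trans (by gcongr; exact le_max_right _ _)
  · exact G.oneShot_le_add x p r fun _ _ y => hfh y

theorem abs_shapley_sub_le {α β C D : ℝ} {f h : G.X → ℝ} (hf : ∀ y, |f y| ≤ C)
    (hh : ∀ y, |h y| ≤ C) (hfh : ∀ y, |f y - h y| ≤ D) (x : G.X) :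
    |G.shapley α f x - G.shapley β h x| ≤ |α - β| + D := by
  have h1 := G.shapley_le_add (α := α) (β := β) hf hh
    (fun y => by linarith [(abs_le.1 (hfh y)).2]) x
  have h2 := G.shapley_le_add (α := β) (β := α) hh hf
    (fun y => by linarith [(abs_le.1 (hfh y)).1]) x
  rw [abs_sub_comm β α] at h2
  exact abs_le.2 ⟨by linarith, by linarith⟩

theorem oneShot_mul (c : ℝ) (x : G.X) (p : MixedAction (G.actA x))
    (r : MixedAction (G.actB x)) (α : ℝ) (F : G.A → G.B → G.X → ℝ) :
    G.oneShot x p r (c * α) (fun a b y => c * F a b y) = c * G.oneShot x p r α F := by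
  simp_rw [oneShot, Finset.mul_sum]
  refine Finset.sum_congr rfl fun a _ => Finset.sum_congr rfl fun b _ => ?_
  simp_rw [mul_left_comm _ c, ← Finset.mul_sum]
  ring

theorem shapley_mul {c : ℝ} (hc : 0 ≤ c) (α : ℝ) (f : G.X → ℝ) (x : G.X) :
    G.shapley (c * α) (fun y => c * f y) x = c * G.shapley α f x := by
  simp_rw [shapley, Real.mul_iSup_of_nonneg hc, Real.mul_iInf_of_nonneg hc, ← oneShot_mul]

/-- Expected payoff of stage `t + 1`, by recursion on the first stage. -/
def expPayoff : ℕ → G.X → Strategy1 G → Strategy2 G → ℝ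
  | 0, x, σ, τ => G.oneShot x (σ.mixed [] x) (τ.mixed [] x) 1 (fun _ _ _ => 0)
  | t + 1, x, σ, τ => G.oneShot x (σ.mixed [] x) (τ.mixed [] x) 0
      (fun a b y => expPayoff t y (σ.shift (x, a, b)) (τ.shift (x, a, b)))

theorem abs_expPayoff_le (t : ℕ) (x : G.X) (σ : Strategy1 G) (τ : Strategy2 G) :
    |G.expPayoff t x σ τ| ≤ 1 := by
  induction t generalizing x σ τ with
  | zero =>
    have := G.abs_oneShot_le x (σ.mixed [] x) (τ.mixed [] x) (α := 1) (C := 0)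
      (F := fun _ _ _ => 0) (by simp)
    simpa [expPayoff] using this
  | succ t ih =>
    have := G.abs_oneShot_le x (σ.mixed [] x) (τ.mixed [] x) (α := 0) (C := 1)
      (F := fun a b y => G.expPayoff t y (σ.shift (x, a, b)) (τ.shift (x, a, b)))
      (fun a b y => ih _ _ _)
    simpa [expPayoff] using this

theorem histProb_append (x₁ : G.X) (σ : Strategy1 G) (τ : Strategy2 G)
    (h : List (G.X × G.A × G.B)) (y : G.X) (a : G.A) (b : G.B) (x : G.X) :
    G.histProb x₁ σ τ (h ++ [(y, a, b)]) x =
      G.histProb x₁ σ τ h y * σ.play h y a * τ.play h y b * G.q y a b x := by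
  simp [histProb, histProbAux]

theorem histProb_cons (x₁ : G.X) (σ : Strategy1 G) (τ : Strategy2 G)
    (h : List (G.X × G.A × G.B)) (y : G.X) (a : G.A) (b : G.B) (x : G.X) :
    G.histProb x₁ σ τ ((y, a, b) :: h) x =
      if y = x₁ then σ.play [] x₁ a * τ.play [] x₁ b * ∑ z ∈ G.qSupp x₁ a b,
        G.q x₁ a b z * G.histProb z (σ.shift (x₁, a, b)) (τ.shift (x₁, a, b)) h x
      else 0 := by
  induction h using List.reverseRecOn generalizing x with
  | nil =>
    have := G.histProb_append x₁ σ τ [] y a b x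
    rw [List.nil_append] at this
    rw [this]
    by_cases hy : y = x₁
    · subst hy
      simp only [histProb, List.reverse_nil, histProbAux, if_true, mul_ite, mul_one, mul_zero,
        one_mul, Finset.sum_ite_eq]
      split_ifs with hx
      · rfl
      · have : G.q y a b x = 0 := by simpa [qSupp] using hx
        rw [this, mul_zero]
    · simp [histProb, histProbAux, hy]
  | append_singleton h e ih =>
    obtain ⟨z, c, d⟩ := e
    rw [← List.cons_append, histProb_append, ih]
    by_cases hy : y = x₁
    · subst hy
      simp only [if_true, histProb_append, Strategy1.shift, Strategy2.shift, Finset.mul_sum,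
        Finset.sum_mul]
      exact Finset.sum_congr rfl fun _ _ => by ring
    · simp [hy]

theorem hasSum_expPayoff (t : ℕ) (x₁ : G.X) (σ : Strategy1 G) (τ : Strategy2 G) :
    HasSum (fun hx : List (G.X × G.A × G.B) × G.X =>
      if hx.1.length = t then
        G.histProb x₁ σ τ hx.1 hx.2 *
          ∑ a ∈ G.actA hx.2, ∑ b ∈ G.actB hx.2,
            σ.play hx.1 hx.2 a * τ.play hx.1 hx.2 b * G.g hx.2 a b
      else 0) (G.expPayoff t x₁ σ τ) := by
  induction t generalizing x₁ σ τ with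
  | zero =>
    convert hasSum_single (([] : List (G.X × G.A × G.B)), x₁) ?_ using 1
    · simp [expPayoff, oneShot, histProb, histProbAux, Strategy1.mixed, Strategy2.mixed]
    · rintro ⟨h, x⟩ hne
      rcases h with _ | ⟨e, h⟩
      · have : x ≠ x₁ := by rintro rfl; exact hne rfl
        simp [histProb, histProbAux, this]
      · simp
  | succ t ih =>
    set f : List (G.X × G.A × G.B) × G.X → ℝ := fun hx =>
      if hx.1.length = t + 1 then
        G.histProb x₁ σ τ hx.1 hx.2 *
          ∑ a ∈ G.actA hx.2, ∑ b ∈ G.actB hx.2,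
            σ.play hx.1 hx.2 a * τ.play hx.1 hx.2 b * G.g hx.2 a b
      else 0 with hf
    have hsplit : f = fun hx => ∑ a ∈ G.actA x₁, ∑ b ∈ G.actB x₁,
        if hx.1.head? = some (x₁, a, b) then f hx else 0 := by
      funext ⟨h, x⟩
      rcases h with _ | ⟨⟨y, a, b⟩, h⟩
      · simp [hf]
      · by_cases hy : y = x₁
        · subst hy
          simp only [List.head?_cons, Option.some.injEq, Prod.mk.injEq, true_and]
          by_cases ha : a ∈ G.actA y
          · by_cases hb : b ∈ G.actB y
            · rw [Finset.sum_eq_single a, Finset.sum_eq_single b]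
              · simp
              · intro b' _ hb'; rw [if_neg]; rintro ⟨-, rfl⟩; exact hb' rfl
              · exact fun h' => absurd hb h'
              · intro a' _ ha'
                refine Finset.sum_eq_zero fun b' _ => ?_
                rw [if_neg]; rintro ⟨rfl, -⟩; exact ha' rfl
              · exact fun h' => absurd ha h'
            · have : f ((y, a, b) :: h, x) = 0 := by
                simp [hf, histProb_cons, τ.supp [] y b hb]
              simp [this]
          · have : f ((y, a, b) :: h, x) = 0 := by
              simp [hf, histProb_cons, σ.supp [] y a ha]
            simp [this]
        · simp [hf, histProb_cons, hy]
    rw [hsplit, expPayoff, oneShot]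
    refine hasSum_sum fun a _ => hasSum_sum fun b _ => ?_
    have hinj : Function.Injective (fun hx : List (G.X × G.A × G.B) × G.X =>
        ((x₁, a, b) :: hx.1, hx.2)) := by
      rintro ⟨h, x⟩ ⟨h', x'⟩ heq
      simpa using heq
    rw [← hinj.hasSum_iff]
    · rw [zero_mul, zero_add]
      have := (hasSum_sum (s := G.qSupp x₁ a b) fun y _ =>
        (ih y (σ.shift (x₁, a, b)) (τ.shift (x₁, a, b))).mul_left (G.q x₁ a b y)).mul_left
          (σ.play [] x₁ a * τ.play [] x₁ b)
      refine (congrArg (HasSum · _) (funext fun hx => ?_)).mpr this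
      obtain ⟨h, x⟩ := hx
      simp only [Function.comp, List.head?_cons, if_true, hf, List.length_cons,
        Nat.add_right_cancel_iff, histProb_cons]
      split_ifs with hlen
      · rw [mul_assoc, Finset.sum_mul]
        simp only [Strategy1.shift, Strategy2.shift, mul_assoc]
      · simp
    · rintro ⟨h, x⟩ hx
      rcases h with _ | ⟨e, h⟩
      · simp
      · rw [if_neg]
        intro he
        rw [List.head?_cons, Option.some.injEq] at he
        exact hx ⟨(h, x), by simp [he]⟩

theorem stagePayoff_succ (t : ℕ) (x₁ : G.X) (σ : Strategy1 G) (τ : Strategy2 G) :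
    G.stagePayoff x₁ σ τ (t + 1) = G.expPayoff t x₁ σ τ := by
  rw [← (G.hasSum_expPayoff t x₁ σ τ).tsum_eq, stagePayoff]
  simp only [Nat.add_right_cancel_iff]

/-- Payoff in which stage `t + 1` has weight `θ t`. -/
def weightedPayoff (θ : ℕ → ℝ) (x : G.X) (σ : Strategy1 G) (τ : Strategy2 G) : ℝ :=
  ∑' t, θ t * G.expPayoff t x σ τ

/-- Maxmin of the game in which stage `t + 1` has weight `θ t`. -/
def weightedValue (θ : ℕ → ℝ) (x : G.X) : ℝ :=
  ⨆ σ : Strategy1 G, ⨅ τ : Strategy2 G, G.weightedPayoff θ x σ τ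

variable {θ : ℕ → ℝ}

theorem abs_mul_expPayoff_le (θ : ℕ → ℝ) (t : ℕ) (x : G.X) (σ : Strategy1 G)
    (τ : Strategy2 G) : ‖θ t * G.expPayoff t x σ τ‖ ≤ |θ t| := by
  rw [Real.norm_eq_abs, abs_mul]
  exact mul_le_of_le_one_right (abs_nonneg _) (G.abs_expPayoff_le t x σ τ)

theorem summable_mul_expPayoff (hθ : Summable θ) (x : G.X) (σ : Strategy1 G)
    (τ : Strategy2 G) : Summable fun t => θ t * G.expPayoff t x σ τ :=
  Summable.of_norm_bounded hθ.abs fun t => G.abs_mul_expPayoff_le θ t x σ τ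

theorem abs_weightedPayoff_le (hθ : Summable θ) (x : G.X) (σ : Strategy1 G)
    (τ : Strategy2 G) : |G.weightedPayoff θ x σ τ| ≤ ∑' t, |θ t| :=
  tsum_of_norm_bounded hθ.abs.hasSum fun t => G.abs_mul_expPayoff_le θ t x σ τ

theorem abs_weightedValue_le (hθ : Summable θ) (x : G.X) :
    |G.weightedValue θ x| ≤ ∑' t, |θ t| :=
  abs_iSup_le fun σ => abs_iInf_le fun τ => G.abs_weightedPayoff_le hθ x σ τ

theorem weightedPayoff_eq_oneShot (hθ : Summable θ) (x : G.X) (σ : Strategy1 G)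
    (τ : Strategy2 G) :
    G.weightedPayoff θ x σ τ = G.oneShot x (σ.mixed [] x) (τ.mixed [] x) (θ 0)
      (fun a b y => G.weightedPayoff (fun t => θ (t + 1)) y
        (σ.shift (x, a, b)) (τ.shift (x, a, b))) := by
  have hθ' : Summable fun t => θ (t + 1) := (summable_nat_add_iff 1).2 hθ
  rw [weightedPayoff, (G.summable_mul_expPayoff hθ x σ τ).tsum_eq_zero_add]
  have h0 : θ 0 * G.expPayoff 0 x σ τ =
      ∑ a ∈ G.actA x, ∑ b ∈ G.actB x, (σ.mixed [] x).1 a * (τ.mixed [] x).1 b *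
        (θ 0 * G.g x a b) := by
    simp only [expPayoff, oneShot, Finset.mul_sum, one_mul, mul_zero, Finset.sum_const_zero,
      add_zero]
    exact Finset.sum_congr rfl fun a _ => Finset.sum_congr rfl fun b _ => by ring
  have h1 : HasSum (fun t => θ (t + 1) * G.expPayoff (t + 1) x σ τ)
      (∑ a ∈ G.actA x, ∑ b ∈ G.actB x, (σ.mixed [] x).1 a * (τ.mixed [] x).1 b *
        ∑ y ∈ G.qSupp x a b, G.q x a b y * G.weightedPayoff (fun t => θ (t + 1)) y
          (σ.shift (x, a, b)) (τ.shift (x, a, b))) := by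
    have := hasSum_sum (s := G.actA x) fun a _ => hasSum_sum (s := G.actB x) fun b _ =>
      (hasSum_sum (s := G.qSupp x a b) fun y _ =>
        (G.summable_mul_expPayoff hθ' y (σ.shift (x, a, b)) (τ.shift (x, a, b))).hasSum.mul_left
          (G.q x a b y)).mul_left ((σ.mixed [] x).1 a * (τ.mixed [] x).1 b)
    refine (congrArg (HasSum · _) (funext fun t => ?_)).mpr this
    simp only [expPayoff, oneShot, zero_mul, zero_add, Finset.mul_sum]
    exact Finset.sum_congr rfl fun a _ => Finset.sum_congr rfl fun b _ =>
      Finset.sum_congr rfl fun y _ => by ring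
  rw [h0, h1.tsum_eq, oneShot, ← Finset.sum_add_distrib]
  refine Finset.sum_congr rfl fun a _ => ?_
  rw [← Finset.sum_add_distrib]
  exact Finset.sum_congr rfl fun b _ => by ring

theorem weightedPayoff_concat1 (θ : ℕ → ℝ) (y : G.X) (r : ∀ x, MixedAction (G.actA x))
    (T : G.X × G.A × G.B → G.X → Strategy1 G) (e : G.X × G.A × G.B) (τ : Strategy2 G) :
    G.weightedPayoff θ y ((Strategy1.concat r T).shift e) τ =
      G.weightedPayoff θ y (T e y) τ :=
  tsum_congr fun t => by cases t <;> rfl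

theorem weightedPayoff_concat2 (θ : ℕ → ℝ) (y : G.X) (r : ∀ x, MixedAction (G.actB x))
    (T : G.X × G.A × G.B → G.X → Strategy2 G) (e : G.X × G.A × G.B) (σ : Strategy1 G) :
    G.weightedPayoff θ y σ ((Strategy2.concat r T).shift e) =
      G.weightedPayoff θ y σ (T e y) :=
  tsum_congr fun t => by cases t <;> rfl

/-- Dynamic programming principle. -/
theorem weightedValue_eq_shapley (hθ : Summable θ) (x : G.X) :
    G.weightedValue θ x =
      G.shapley (θ 0) (G.weightedValue fun t => θ (t + 1)) x := by
  have hθ' : Summable fun t => θ (t + 1) := (summable_nat_add_iff 1).2 hθ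
  set W := G.weightedValue fun t => θ (t + 1) with hW
  have hWb : ∀ y, |W y| ≤ ∑' t, |θ (t + 1)| := G.abs_weightedValue_le hθ'
  have hKb : ∀ p r, |G.oneShot x p r (θ 0) (fun _ _ y => W y)| ≤
      |θ 0| + ∑' t, |θ (t + 1)| := fun p r => G.abs_oneShot_le x p r fun _ _ y => hWb y
  apply le_antisymm
  · refine ciSup_le fun σ => le_of_forall_pos_le_add fun ε hε => ?_
    obtain ⟨r, hr⟩ := exists_lt_of_ciInf_lt (lt_add_of_pos_right
      (⨅ r, G.oneShot x (σ.mixed [] x) r (θ 0) (fun _ _ y => W y)) (half_pos hε))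
    have hbest : ∀ (e : G.X × G.A × G.B) (y : G.X), ∃ τ : Strategy2 G,
        G.weightedPayoff (fun t => θ (t + 1)) y (σ.shift e) τ ≤ W y + ε / 2 := by
      intro e y
      obtain ⟨τ, hτ⟩ := exists_lt_of_ciInf_lt (lt_add_of_pos_right
        (⨅ τ, G.weightedPayoff (fun t => θ (t + 1)) y (σ.shift e) τ) (half_pos hε))
      have : (⨅ τ, G.weightedPayoff (fun t => θ (t + 1)) y (σ.shift e) τ) ≤ W y :=
        le_ciSup (f := fun σ => ⨅ τ, G.weightedPayoff (fun t => θ (t + 1)) y σ τ)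
          (bddAbove_of_abs_le fun σ => abs_iInf_le fun τ =>
            G.abs_weightedPayoff_le hθ' y σ τ) (σ.shift e)
      exact ⟨τ, by linarith⟩
    choose T hT using hbest
    let ρ : ∀ z, MixedAction (G.actB z) :=
      Function.update (fun z => Classical.arbitrary (MixedAction (G.actB z))) x r
    have hρ : ((Strategy2.concat ρ T).mixed [] x) = r := by
      apply Subtype.ext
      change (ρ x).1 = r.1
      simp [ρ]
    have h1 : G.weightedPayoff θ x σ (Strategy2.concat ρ T) ≤
        G.oneShot x (σ.mixed [] x) r (θ 0) (fun _ _ y => W y) + (|θ 0 - θ 0| + ε / 2) := by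
      rw [G.weightedPayoff_eq_oneShot hθ, hρ]
      refine G.oneShot_le_add x _ _ fun a b y => ?_
      rw [weightedPayoff_concat2]
      exact hT (x, a, b) y
    rw [sub_self, abs_zero, zero_add] at h1
    have h2 : (⨅ τ, G.weightedPayoff θ x σ τ) ≤ G.weightedPayoff θ x σ (Strategy2.concat ρ T) :=
      ciInf_le (bddBelow_of_abs_le fun τ => G.abs_weightedPayoff_le hθ x σ τ) _
    have h3 : (⨅ r, G.oneShot x (σ.mixed [] x) r (θ 0) (fun _ _ y => W y)) ≤
        G.shapley (θ 0) W x :=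
      le_ciSup (f := fun p => ⨅ r, G.oneShot x p r (θ 0) (fun _ _ y => W y))
        (bddAbove_of_abs_le fun p => abs_iInf_le (hKb p)) (σ.mixed [] x)
    linarith
  · refine ciSup_le fun p => le_of_forall_pos_le_add fun ε hε => ?_
    have hbest : ∀ (y : G.X), ∃ σ : Strategy1 G, ∀ τ,
        W y ≤ G.weightedPayoff (fun t => θ (t + 1)) y σ τ + ε := by
      intro y
      obtain ⟨σ, hσ⟩ := exists_lt_of_lt_ciSup (sub_lt_self (W y) hε)
      refine ⟨σ, fun τ => ?_⟩
      have : (⨅ τ, G.weightedPayoff (fun t => θ (t + 1)) y σ τ) ≤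
          G.weightedPayoff (fun t => θ (t + 1)) y σ τ :=
        ciInf_le (bddBelow_of_abs_le fun τ => G.abs_weightedPayoff_le hθ' y σ τ) _
      linarith
    choose T hT using hbest
    let ρ : ∀ z, MixedAction (G.actA z) :=
      Function.update (fun z => Classical.arbitrary (MixedAction (G.actA z))) x p
    let σ := Strategy1.concat ρ fun _ y => T y
    have hρ : (σ.mixed [] x) = p := by
      apply Subtype.ext
      change (ρ x).1 = p.1
      simp [ρ]
    have h1 : (⨅ r, G.oneShot x p r (θ 0) (fun _ _ y => W y)) - ε ≤
        ⨅ τ, G.weightedPayoff θ x σ τ := by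
      refine le_ciInf fun τ => ?_
      have h2 : G.oneShot x p (τ.mixed [] x) (θ 0) (fun _ _ y => W y) ≤
          G.weightedPayoff θ x σ τ + (|θ 0 - θ 0| + ε) := by
        rw [G.weightedPayoff_eq_oneShot hθ, hρ]
        refine G.oneShot_le_add x _ _ fun a b y => ?_
        rw [weightedPayoff_concat1]
        exact hT y _
      rw [sub_self, abs_zero, zero_add] at h2
      have h3 := ciInf_le (bddBelow_of_abs_le (hKb p)) (τ.mixed [] x)
      linarith
    have h4 : (⨅ τ, G.weightedPayoff θ x σ τ) ≤ G.weightedValue θ x :=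
      le_ciSup (f := fun σ => ⨅ τ, G.weightedPayoff θ x σ τ)
        (bddAbove_of_abs_le fun σ => abs_iInf_le fun τ =>
          G.abs_weightedPayoff_le hθ x σ τ) σ
    linarith

theorem weightedValue_mul {c : ℝ} (hc : 0 ≤ c) (θ : ℕ → ℝ) (x : G.X) :
    G.weightedValue (fun t => c * θ t) x = c * G.weightedValue θ x := by
  simp_rw [weightedValue, Real.mul_iSup_of_nonneg hc, Real.mul_iInf_of_nonneg hc,
    weightedPayoff, mul_assoc, tsum_mul_left]

/-- The weights of the `n`-stage total payoff. -/
def unitWeights (n : ℕ) (t : ℕ) : ℝ := if t < n then 1 else 0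

theorem hasSum_unitWeights (n : ℕ) : HasSum (unitWeights n) n := by
  have : HasSum (unitWeights n) (∑ t ∈ Finset.range n, unitWeights n t) :=
    hasSum_sum_of_ne_finset_zero fun t ht => by
      rw [Finset.mem_range] at ht; simp [unitWeights, ht]
  convert this using 1
  have h1 : ∀ t ∈ Finset.range n, unitWeights n t = 1 := fun t ht =>
    if_pos (Finset.mem_range.1 ht)
  rw [Finset.sum_congr rfl h1]
  simp

theorem avgPayoff_eq (n : ℕ) (x : G.X) (σ : Strategy1 G) (τ : Strategy2 G) :
    G.avgPayoff x σ τ n = (n : ℝ)⁻¹ * G.weightedPayoff (unitWeights n) x σ τ := by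
  rw [avgPayoff, weightedPayoff, tsum_eq_sum (s := Finset.range n)]
  · congr 1
    rw [← Finset.Ico_add_one_right_eq_Icc, Finset.sum_Ico_eq_sum_range]
    refine Finset.sum_congr (by simp) fun t ht => ?_
    rw [add_comm 1 t, stagePayoff_succ]
    rw [Finset.mem_range] at ht
    rw [unitWeights, if_pos (by omega), one_mul]
  · intro t ht
    rw [Finset.mem_range] at ht
    simp [unitWeights, ht]

theorem nValue_eq (n : ℕ) (x : G.X) :
    G.nValue n x = (n : ℝ)⁻¹ * G.weightedValue (unitWeights n) x := by
  have hn : (0 : ℝ) ≤ (n : ℝ)⁻¹ := by positivity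
  simp_rw [nValue, avgPayoff_eq, weightedValue, Real.mul_iSup_of_nonneg hn,
    Real.mul_iInf_of_nonneg hn]

theorem weightedValue_unitWeights (n : ℕ) (x : G.X) :
    G.weightedValue (unitWeights n) x = n * G.nValue n x := by
  rcases Nat.eq_zero_or_pos n with rfl | hn
  · have := G.abs_weightedValue_le (hasSum_unitWeights 0).summable x
    simpa [unitWeights] using this
  · have : (n : ℝ) ≠ 0 := by positivity
    rw [nValue_eq, mul_inv_cancel_left₀ this]

theorem abs_nValue_le (n : ℕ) (x : G.X) : |G.nValue n x| ≤ 1 := by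
  have h1 := G.abs_weightedValue_le (hasSum_unitWeights n).summable x
  have h2 : ∀ t, |unitWeights n t| = unitWeights n t := fun t =>
    abs_of_nonneg (by unfold unitWeights; split_ifs <;> norm_num)
  simp_rw [h2, (hasSum_unitWeights n).tsum_eq] at h1
  rw [nValue_eq, abs_mul, abs_of_nonneg (by positivity)]
  exact (mul_le_mul_of_nonneg_left h1 (by positivity)).trans inv_mul_le_one

theorem nValue_succ (n : ℕ) (x : G.X) :
    ((n : ℝ) + 1) * G.nValue (n + 1) x = G.shapley 1 (fun y => n * G.nValue n y) x := by
  have h := G.weightedValue_eq_shapley (hasSum_unitWeights (n + 1)).summable x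
  have h0 : unitWeights (n + 1) 0 = 1 := by simp [unitWeights]
  have h1 : (fun t => unitWeights (n + 1) (t + 1)) = unitWeights n := by
    funext t; simp [unitWeights]
  rw [h0, h1, weightedValue_unitWeights, funext (G.weightedValue_unitWeights n)] at h
  exact_mod_cast h

theorem hasSum_discount {l : ℝ} (h0 : 0 < l) (h1 : l ≤ 1) :
    HasSum (fun t : ℕ => l * (1 - l) ^ t) 1 := by
  have := (hasSum_geometric_of_lt_one (r := 1 - l) (by linarith) (by linarith)).mul_left l
  rwa [sub_sub_cancel, mul_inv_cancel₀ h0.ne'] at this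

theorem lamValue_eq (l : ℝ) (x : G.X) :
    G.lamValue l x = G.weightedValue (fun t => l * (1 - l) ^ t) x := by
  simp_rw [lamValue, discPayoff, weightedValue, weightedPayoff, stagePayoff_succ]

theorem abs_lamValue_le {l : ℝ} (h0 : 0 < l) (h1 : l ≤ 1) (x : G.X) :
    |G.lamValue l x| ≤ 1 := by
  have h := G.abs_weightedValue_le (hasSum_discount h0 h1).summable x
  have h2 : ∀ t : ℕ, |l * (1 - l) ^ t| = l * (1 - l) ^ t := fun t =>
    abs_of_nonneg (mul_nonneg h0.le (pow_nonneg (by linarith) t))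
  simp_rw [h2, (hasSum_discount h0 h1).tsum_eq] at h
  rwa [lamValue_eq]

theorem lamValue_eq_shapley {l : ℝ} (h0 : 0 < l) (h1 : l ≤ 1) (x : G.X) :
    G.lamValue l x = G.shapley l (fun y => (1 - l) * G.lamValue l y) x := by
  have h := G.weightedValue_eq_shapley (hasSum_discount h0 h1).summable x
  have h2 : (fun t : ℕ => l * (1 - l) ^ (t + 1)) =
      fun t => (1 - l) * (l * (1 - l) ^ t) := by
    funext t; ring
  have h3 : (G.weightedValue fun t => (1 - l) * (l * (1 - l) ^ t)) =
      fun y => (1 - l) * G.lamValue l y := by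
    funext y
    rw [weightedValue_mul _ (by linarith), lamValue_eq]
  rw [h2, h3, pow_zero, mul_one] at h
  rw [lamValue_eq, h]

theorem isShapleySystem : IsShapleySystem G.shapley G.nValue G.lamValue where
  lipschitz := G.abs_shapley_sub_le
  homogeneous := G.shapley_mul
  avg_abs_le := G.abs_nValue_le
  disc_abs_le := G.abs_lamValue_le
  avg_rec := G.nValue_succ
  disc_rec := G.lamValue_eq_shapley

end StocGame

/-- uniform Tauberian theorem for recursive games. In a two-player
zero-sum recursive game with countable state space and finite action sets at each
state, the `n`-stage values `(v_n)` converge uniformly as `n → ∞` if and only if the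
`λ`-discounted values `(v_λ)_{λ ∈ (0,1]}` converge uniformly as `λ → 0`; and in case
of convergence both limits are the same. -/
theorem recursive_game_uniform_tauberian
    (G : RecGame) (hcount : Countable G.X) :
    ((∃ v : G.X → ℝ, ∀ ε > (0 : ℝ), ∃ N : ℕ, ∀ n ≥ N, ∀ x,
        |G.toStocGame.nValue n x - v x| ≤ ε) ↔
      (∃ w : G.X → ℝ, ∀ ε > (0 : ℝ), ∃ δ > (0 : ℝ), ∀ lam : ℝ,
        0 < lam → lam ≤ 1 → lam ≤ δ → ∀ x,
        |G.toStocGame.lamValue lam x - w x| ≤ ε)) ∧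
    (∀ v w : G.X → ℝ,
      (∀ ε > (0 : ℝ), ∃ N : ℕ, ∀ n ≥ N, ∀ x, |G.toStocGame.nValue n x - v x| ≤ ε) →
      (∀ ε > (0 : ℝ), ∃ δ > (0 : ℝ), ∀ lam : ℝ, 0 < lam → lam ≤ 1 → lam ≤ δ → ∀ x,
        |G.toStocGame.lamValue lam x - w x| ≤ ε) →
      v = w) := by
  have H := G.toStocGame.isShapleySystem
  refine ⟨⟨fun ⟨v, hv⟩ => ⟨v, H.disc_tendsto hv⟩, fun ⟨w, hw⟩ => ⟨w, H.avg_tendsto hw⟩⟩, ?_⟩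
  intro v w hv hw
  funext x
  refine eq_of_forall_dist_le fun ε hε => ?_
  obtain ⟨N, hN⟩ := hv (ε / 2) (half_pos hε)
  obtain ⟨N', hN'⟩ := H.avg_tendsto hw (ε / 2) (half_pos hε)
  have h1 := hN (max N N') (le_max_left _ _) x
  have h2 := hN' (max N N') (le_max_right _ _) x
  rw [Real.dist_eq]
  have h3 := abs_sub_le (v x) (G.toStocGame.nValue (max N N') x) (w x)
  rw [abs_sub_comm (v x) (G.toStocGame.nValue _ x)] at h3
  linarith
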